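/- Let A be the companion matrix of f(x) = (x−1)⁶ and B the companion matrix of g(x) = (x+1)⁴(x²+x+1), regarded as elements of GL₆(ℚ), and set T = B·A⁻¹. Then T and B generate a free group of rank 2: the group homomorphism from the free group on two generators to GL₆(ℚ) sending the first generator to T and the second generator to B is injective. (This is the hypergeometric monodromy group of case A-2, with α = (0,0,0,0,0,0) and β = (1/2,1/2,1/2,1/2,1/3,2/3); in particular this group is isomorphic to ℤ ∗ ℤ.) -/

import Mathlib

open Matrix Polynomial

/-- The companion matrix of a (monic degree `n`) polynomial `p`:
the `n × n` matrix with subdiagonal entries `1`, last column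
`(-c₀, …, -c_{n-1})ᵀ`, and `0` elsewhere. -/
def companionMatrix {K : Type*} [CommRing K] (n : ℕ) (p : Polynomial K) :
    Matrix (Fin n) (Fin n) K :=
  Matrix.of fun i j =>
    if (j : ℕ) + 1 = n then -p.coeff i
    else if (i : ℕ) = (j : ℕ) + 1 then 1 else 0

section PingPong

open Monoid Monoid.CoprodI
open scoped Pointwise

variable {ι G α : Type*} [Group G] [MulAction G α]

/-- A nonempty reduced word acts nontrivially if the ping-pong sets `X k` and `X l` satisfy only
`¬ X k ⊆ X l`; no disjointness is needed when the factor `H l` is infinite. -/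
theorem lift_prod_ne_one_of_not_subset {H : ι → Type*} [∀ i, Group (H i)] (f : ∀ i, H i →* G)
    (X : ι → Set α) (hpp : Pairwise fun i j => ∀ h : H i, h ≠ 1 → f i h • X j ⊆ X i)
    {k l : ι} [Infinite (H l)] (hkl : ¬ X k ⊆ X l) {i j : ι} (w : NeWord H i j) :
    lift f w.prod ≠ 1 := by
  have hne : l ≠ k := by
    rintro rfl
    exact hkl subset_rfl
  have loop : ∀ w : NeWord H l l, lift f w.prod ≠ 1 := by
    intro w hw
    apply hkl
    simpa [hw] using lift_word_ping_pong f X hpp w hne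
  have head : ∀ {j} (w : NeWord H l j), lift f w.prod ≠ 1 := by
    classical
    intro j w hw
    by_cases hj : l = j
    · subst hj
      exact loop w hw
    obtain ⟨h, hh⟩ := Infinite.exists_notMem_finset ({1, w.head⁻¹} : Finset (H l))
    simp only [Finset.mem_insert, Finset.mem_singleton, not_or] at hh
    have h_head : h * w.head ≠ 1 := fun e => hh.2 (eq_inv_of_mul_eq_one_left e)
    refine loop (.append (.mulHead w h h_head) (Ne.symm hj)
      (.singleton h⁻¹ (inv_ne_one.mpr hh.1))) ?_
    simp [hw]
  by_cases hi : l = i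
  · subst hi
    exact head w
  by_cases hj : l = j
  · subst hj
    intro hw
    exact head w.inv (by simp [hw])
  obtain ⟨h, hh⟩ := exists_ne (1 : H l)
  intro hw
  refine loop (.append (.singleton h hh) hi (.append w (Ne.symm hj)
    (.singleton h⁻¹ (inv_ne_one.mpr hh)))) ?_
  simp [hw]

/-- A ping-pong lemma for free groups, with sets that need not be disjoint. -/
theorem FreeGroup.lift_injective_of_zpow_ping_pong (a : ι → G) (X : ι → Set α)
    (hpp : Pairwise fun i j => ∀ n : ℤ, n ≠ 0 → ∀ x ∈ X j, a i ^ n • x ∈ X i)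
    {k l : ι} (hkl : ¬ X k ⊆ X l) : Function.Injective (FreeGroup.lift a) := by
  classical
  have hcomp : FreeGroup.lift a =
      (CoprodI.lift fun i => FreeGroup.lift fun _ => a i).comp
        (@freeGroupEquivCoprodI ι).toMonoidHom := by
    ext i
    simp
  rw [hcomp, MonoidHom.coe_comp]
  refine Function.Injective.comp ?_ (MulEquiv.injective freeGroupEquivCoprodI)
  have hpp' : Pairwise fun i j => ∀ h : FreeGroup Unit, h ≠ 1 →
      (FreeGroup.lift fun _ => a i) h • X j ⊆ X i := by
    intro i j hij
    refine FreeGroup.freeGroupUnitEquivInt.forall_congr_left.mpr ?_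
    intro n hn
    have hn0 : n ≠ 0 := by
      rintro rfl
      exact hn (by simp [FreeGroup.freeGroupUnitEquivInt])
    change FreeGroup.lift (fun _ => a i) (FreeGroup.of () ^ n) • X j ⊆ X i
    simp only [map_zpow, FreeGroup.lift_apply_of]
    rintro _ ⟨x, hx, rfl⟩
    exact hpp hij n hn0 x hx
  refine (injective_iff_map_eq_one _).mpr fun x hx => ?_
  obtain ⟨w, rfl⟩ := CoprodI.Word.equiv.symm.surjective x
  by_contra hne
  have hw : w ≠ Word.empty := by
    rintro rfl
    exact hne Word.prod_empty
  obtain ⟨i, j, w, rfl⟩ := NeWord.of_word w hw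
  exact lift_prod_ne_one_of_not_subset (fun i => FreeGroup.lift fun _ : Unit => a i) X hpp' hkl w hx

end PingPong

/-- Ping-pong for a transvection `T` and a map `B`, played with the cones `C` and `D` up to sign.
The involution `e` preserves `C` and conjugates both `T` and `B` to their inverses. -/
theorem FreeGroup.lift_injective_of_cones {G V : Type*} [Group G] [AddCommGroup V] [Module ℚ V]
    [MulAction G V] {T B : G} {φ : V →ₗ[ℚ] ℚ} {u : V} {b e : V →ₗ[ℚ] V} {C D : PointedCone ℚ V}
    (hT : ∀ v, T • v = v + φ v • u) (hB : ∀ v, B • v = -b v)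
    (hee : ∀ v, e (e v) = v) (hbe : ∀ v, b (e (b (e v))) = v)
    (heu : e u = u) (hφe : ∀ v, φ (e v) = -φ v) (hφu : φ u = 0) (hu0 : u ≠ 0) (hu : u ∈ C)
    (heC : ∀ v ∈ C, e v ∈ C) (hbC : ∀ v ∈ C, b v ∈ D) (hbD : ∀ v ∈ D, b v ∈ D)
    (hpos : ∀ v ∈ D, v ≠ 0 → 0 < φ v)
    (hadd : ∀ v ∈ D, φ v • u + v ∈ C) (hsub : ∀ v ∈ D, φ v • u - v ∈ C) :
    Function.Injective (FreeGroup.lift ![T, B]) := by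
  have he0 : ∀ {v}, v ≠ 0 → e v ≠ 0 := fun {v} hv h => hv (by rw [← hee v, h, map_zero])
  have hB0 : ∀ {v : V}, v ≠ 0 → B • v ≠ 0 := fun {v} hv h =>
    hv (smul_left_cancel B (by rw [h, hB, map_zero, neg_zero]))
  let P : V → Prop := fun y => y ≠ 0 ∧ (y ∈ D ∨ -y ∈ D)
  let Q : V → Prop := fun x => x ≠ 0 ∧ (x ∈ C ∨ -x ∈ C)
  have hQe : ∀ x, Q x → Q (e x) := by
    rintro x ⟨hx0, hx | hx⟩
    · exact ⟨he0 hx0, .inl (heC x hx)⟩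
    · exact ⟨he0 hx0, .inr (by simpa using heC _ hx)⟩
  have hQP : ∀ x, Q x → P (B • x) := by
    rintro x ⟨hx0, hx | hx⟩
    · exact ⟨hB0 hx0, .inr (by simpa [hB] using hbC x hx)⟩
    · exact ⟨hB0 hx0, .inl (by simpa [hB] using hbC _ hx)⟩
  have hPP : ∀ x, P x → P (B • x) := by
    rintro x ⟨hx0, hx | hx⟩
    · exact ⟨hB0 hx0, .inr (by simpa [hB] using hbD x hx)⟩
    · exact ⟨hB0 hx0, .inl (by simpa [hB] using hbD _ hx)⟩
  have hBpow : ∀ n : ℕ, ∀ x, Q x → P (B ^ (n + 1) • x) := by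
    intro n x hx
    induction n with
    | zero => simpa using hQP x hx
    | succ n ih =>
      rw [pow_succ', mul_smul]
      exact hPP _ ih
  have hBinv : ∀ v, e (B⁻¹ • v) = B • e v := by
    intro v
    have h : B⁻¹ • v = -e (b (e v)) := by
      rw [inv_smul_eq_iff, hB, map_neg, hbe, neg_neg]
    rw [h, map_neg, hee, hB]
  have hBinvpow : ∀ n : ℕ, ∀ v, e ((B ^ n)⁻¹ • v) = B ^ n • e v := by
    intro n
    induction n with
    | zero => simp
    | succ n ih =>
      intro v
      rw [pow_succ, _root_.mul_inv_rev, mul_smul, hBinv, ih, ← mul_smul, ← pow_succ', ← pow_succ]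
  have hTinv : ∀ v, T⁻¹ • v = v - φ v • u := by
    intro v
    rw [inv_smul_eq_iff, hT]
    simp [hφu]
  have hTpow : ∀ n : ℤ, ∀ v, T ^ n • v = v + ((n : ℚ) * φ v) • u := by
    intro n
    induction n with
    | zero => simp
    | succ n ih =>
      intro v
      rw [_root_.zpow_add_one, mul_smul, hT, ih]
      simp only [map_add, map_smul, hφu, smul_zero, add_zero]
      push_cast
      module
    | pred n ih =>
      intro v
      rw [_root_.zpow_sub_one, mul_smul, hTinv, ih]
      simp only [map_sub, map_smul, hφu, smul_zero, sub_zero]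
      push_cast
      module
  have hDu : ∀ y ∈ D, ∀ r : ℚ, 0 ≤ r → (r * φ y) • u ∈ C := by
    intro y hy r hr
    by_cases hy0 : y = 0
    · simp [hy0]
    · exact C.smul_mem (mul_nonneg hr (hpos y hy hy0).le) hu
  have hTD : ∀ n : ℤ, n ≠ 0 → ∀ y, P y → Q (T ^ n • y) := by
    have key : ∀ n : ℤ, n ≠ 0 → ∀ y ∈ D, T ^ n • y ∈ C ∨ -(T ^ n • y) ∈ C := by
      intro n hn y hy
      rcases lt_or_gt_of_ne hn with h | h
      · right
        have hr : (0 : ℚ) ≤ -n - 1 := by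
          have : (n : ℚ) ≤ -1 := by exact_mod_cast (by omega : n ≤ -1)
          linarith
        have := C.add_mem (hsub y hy) (hDu y hy _ hr)
        convert this using 1
        rw [hTpow]
        module
      · left
        have hr : (0 : ℚ) ≤ n - 1 := by
          have : (1 : ℚ) ≤ n := by exact_mod_cast (by omega : 1 ≤ n)
          linarith
        have := C.add_mem (hadd y hy) (hDu y hy _ hr)
        convert this using 1
        rw [hTpow]
        module
    rintro n hn y ⟨hy0, hy⟩
    have hneg : T ^ n • (-y) = -(T ^ n • y) := by
      rw [hTpow, hTpow, map_neg]
      module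
    refine ⟨?_, ?_⟩
    · intro h
      apply hy0
      rw [← inv_smul_eq_iff.mpr h.symm, ← _root_.zpow_neg, hTpow]
      simp
    · rcases hy with hy | hy
      · exact key n hn y hy
      · have := key n hn _ hy
        rw [hneg, neg_neg] at this
        exact this.symm
  let X : Fin 2 → Set V := ![{x | Q x}, {y | P y ∨ P (e y)}]
  refine FreeGroup.lift_injective_of_zpow_ping_pong ![T, B] X ?_ (k := 0) (l := 1) ?_
  · intro i j hij n hn x hx
    fin_cases i <;> fin_cases j
    · exact absurd rfl hij
    · change Q (T ^ n • x)
      rcases hx with hx | hx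
      · exact hTD n hn x hx
      · have := hQe _ (hTD (-n) (neg_ne_zero.mpr hn) _ hx)
        convert this using 1
        rw [hTpow, hTpow, map_add, map_smul, hee, heu, hφe]
        simp
    · change P (B ^ n • x) ∨ P (e (B ^ n • x))
      obtain ⟨m, rfl | rfl⟩ := n.eq_nat_or_neg
      · obtain ⟨m, rfl⟩ := Nat.exists_eq_succ_of_ne_zero (by simpa using hn : m ≠ 0)
        left
        rw [_root_.zpow_natCast]
        exact hBpow m x hx
      · obtain ⟨m, rfl⟩ := Nat.exists_eq_succ_of_ne_zero (by simpa using hn : m ≠ 0)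
        right
        rw [_root_.zpow_neg, _root_.zpow_natCast, hBinvpow]
        exact hBpow m _ (hQe x hx)
    · exact absurd rfl hij
  · intro h
    have hφP : ¬ P u := by
      rintro ⟨-, hu' | hu'⟩
      · exact (hpos u hu' hu0).ne' hφu
      · exact (hpos _ hu' (neg_ne_zero.mpr hu0)).ne' (by simp [hφu])
    have hmem : P u ∨ P (e u) := h (show Q u from ⟨hu0, .inl hu⟩)
    rw [heu, or_self] at hmem
    exact hφP hmem

/-- The matrix of `-B`. -/
def negBMatrix : Matrix (Fin 6) (Fin 6) ℤ :=
  !![0, 0, 0, 0, 0, 1;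
    -1, 0, 0, 0, 0, 5;
    0, -1, 0, 0, 0, 11;
    0, 0, -1, 0, 0, 14;
    0, 0, 0, -1, 0, 11;
    0, 0, 0, 0, -1, 5]

/-- An involution conjugating `T` and `B` to their inverses. -/
def flipMatrix : Matrix (Fin 6) (Fin 6) ℤ :=
  !![-1, 0, 0, 0, 0, 0;
    -5, 0, 0, 0, 0, 1;
    -11, 0, 0, 0, 1, 0;
    -14, 0, 0, 1, 0, 0;
    -11, 0, 1, 0, 0, 0;
    -5, 1, 0, 0, 0, 0]

/-- The direction of the transvection `T`. -/
def transvVec : Fin 6 → ℤ := ![0, -11, 4, -34, 4, -11]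

/-- Generators of the cone containing, up to sign, the ping-pong set of `T`. -/
def coneGensT : Fin 24 → Fin 6 → ℤ :=
  ![![89, -205, 770, -890, 565, -329],
    ![-89, -774, -414, -2136, -209, -650],
    ![0, -3, 8, -10, 8, -3],
    ![7, -29, 58, -70, 47, -13],
    ![-7, -48, -30, -168, -19, -64],
    ![0, -1, 4, -6, 4, -1],
    ![1, -5, 10, -10, 5, -1],
    ![-1, -6, -6, -24, -1, -10],
    ![3, -12, 39, -49, 31, -20],
    ![-3, -35, -2, -91, 6, -27],
    ![-3, -39, -19, -108, -11, -31],
    ![3, -16, 22, -66, 14, -24],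
    ![-2, -30, -15, -90, -11, -30],
    ![2, -20, 11, -62, 7, -20],
    ![-3, -33, -19, -94, -14, -29],
    ![3, -14, 19, -52, 14, -18],
    ![3, -14, 44, -55, 38, -21],
    ![-3, -36, 5, -97, 11, -29],
    ![-1, -18, -8, -57, -2, -23],
    ![1, -18, 9, -43, 3, -13],
    ![2, -10, 28, -35, 25, -11],
    ![-2, -21, 3, -63, 6, -20],
    ![-1, -22, -10, -68, -7, -24],
    ![1, -19, 4, -54, 1, -17]]

/-- Generators of the cone containing, up to sign, half of the ping-pong set of `B`. -/
def coneGensB : Fin 29 → Fin 6 → ℤ :=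
  ![![-329, -1734, -3414, -5376, -2729, -2210],
    ![-3, -15, -30, -50, -23, -23],
    ![-13, -72, -114, -240, -73, -112],
    ![-64, -313, -656, -866, -536, -301],
    ![-1, -5, -10, -18, -5, -9],
    ![-1, -6, -6, -24, -1, -10],
    ![-20, -103, -208, -319, -171, -131],
    ![-24, -123, -248, -358, -198, -134],
    ![-18, -93, -184, -271, -146, -104],
    ![-21, -108, -217, -338, -176, -143],
    ![-13, -66, -125, -191, -100, -68],
    ![-11, -57, -111, -182, -86, -80],
    ![-1, -4, -7, -7, -4, -1],
    ![-1152, -5425, -10980, -12390, -8036, -2481],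
    ![-1233, -5749, -11466, -12714, -8117, -2481],
    ![-1233, -5668, -11142, -12228, -7793, -2400],
    ![-1152, -5263, -10332, -11418, -7388, -2319],
    ![-1071, -4939, -9846, -11094, -7307, -2319],
    ![-1071, -5020, -10170, -11580, -7631, -2400],
    ![-91, -406, -775, -829, -514, -145],
    ![-4, -17, -31, -32, -19, -5],
    ![-43, -211, -448, -547, -379, -164],
    ![-23, -112, -238, -292, -203, -92],
    ![-112, -547, -1160, -1454, -992, -487],
    ![-9, -44, -94, -116, -81, -40],
    ![-40, -191, -396, -466, -324, -119],
    ![-56, -263, -532, -604, -400, -128],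
    ![-378, -1791, -3656, -4196, -2814, -918],
    ![-107, -505, -1015, -1140, -742, -228]]

/-- Combinations expressing `flipMatrix *ᵥ coneGensT i` in `coneGensT`. -/
def flipCert : Fin 24 → ℕ × List (ℕ × Fin 24) :=
  ![(1, [(1, 1)]),
    (1, [(1, 0)]),
    (1, [(1, 2)]),
    (1, [(1, 4)]),
    (1, [(1, 3)]),
    (1, [(1, 5)]),
    (1, [(1, 7)]),
    (1, [(1, 6)]),
    (1, [(1, 9)]),
    (1, [(1, 8)]),
    (1, [(1, 11)]),
    (1, [(1, 10)]),
    (1, [(1, 13)]),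
    (1, [(1, 12)]),
    (1, [(1, 15)]),
    (1, [(1, 14)]),
    (1, [(1, 17)]),
    (1, [(1, 16)]),
    (1, [(1, 19)]),
    (1, [(1, 18)]),
    (1, [(1, 21)]),
    (1, [(1, 20)]),
    (1, [(1, 23)]),
    (1, [(1, 22)])]

/-- Combinations expressing `negBMatrix *ᵥ coneGensT i` in `coneGensB`. -/
def negBCertT : Fin 24 → ℕ × List (ℕ × Fin 29) :=
  ![(1, [(1, 0)]),
    (65, [(24, 0), (5340, 12), (445, 3), (534, 5)]),
    (1, [(1, 1)]),
    (1, [(1, 2)]),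
    (1, [(1, 3)]),
    (1, [(1, 4)]),
    (1, [(1, 5)]),
    (1, [(1, 24), (1, 4)]),
    (1, [(1, 6)]),
    (104887, [(5390, 22), (25280, 10), (448270, 12), (158838, 1), (8965, 21), (53453, 6)]),
    (8100, [(6372, 7), (180, 8), (7, 13), (38644, 12), (721, 3), (2080, 5)]),
    (1, [(1, 7)]),
    (38343988, [(32656492, 12), (2686396, 21), (78495, 16), (9299336, 10), (7662923, 3),
      (16689080, 8)]),
    (17902659, [(20599, 16), (1026777, 2), (12580112, 8), (4600174, 10), (801175, 21),
      (280228, 12)]),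
    (9677502, [(17593756, 12), (1729728, 10), (2912562, 8), (25207, 13), (2430487, 3),
      (3551590, 5)]),
    (1, [(1, 8)]),
    (1, [(1, 9)]),
    (70029, [(2330, 21), (186754, 12), (34261, 10), (5996, 6), (9466, 3), (190920, 1)]),
    (227664, [(74760, 12), (1153, 0), (26784, 11), (24280, 2), (27906, 23), (116271, 24)]),
    (1, [(1, 10)]),
    (1, [(1, 11)]),
    (3408, [(1189, 5), (3108, 12), (451, 4), (192, 10), (727, 3), (4796, 1)]),
    (78452, [(9290, 6), (765, 2), (144394, 12), (19741, 21), (7920, 9), (29307, 8)]),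
    (4622641, [(1289391, 8), (587860, 2), (478163, 21), (7080, 17), (41350, 1), (1497380, 10)])]

/-- Combinations expressing `negBMatrix *ᵥ coneGensB i` in `coneGensB`. -/
def negBCertB : Fin 29 → ℕ × List (ℕ × Fin 29) :=
  ![(1236627, [(99732060, 12), (2621, 15), (51980535, 22), (30976020, 21), (57805, 16),
      (2759184, 10)]),
    (1, [(1, 22)]),
    (1, [(1, 23)]),
    (675, [(16, 13), (2970, 22), (1026, 24), (11, 14), (2916, 12), (2268, 25)]),
    (1, [(1, 24)]),
    (1, [(1, 24), (1, 4)]),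
    (89904, [(905, 18), (19719, 5), (330518, 22), (33672, 21), (42858, 25), (380, 3)]),
    (1824, [(19, 2), (803, 22), (228, 25), (4440, 21), (9772, 12), (3972, 20)]),
    (11870712, [(53870, 15), (48595, 16), (33387309, 22), (1356588, 21), (6912945, 25),
      (722439, 2)]),
    (9120960, [(628066, 5), (39937410, 22), (33135, 18), (2277360, 21), (27511, 0), (6066090, 25)]),
    (11664, [(109, 18), (52332, 12), (2205, 4), (10272, 21), (4108, 22), (1339, 3)]),
    (28944, [(1160, 20), (7822, 24), (86160, 22), (3, 16), (6045, 25), (1042, 2)]),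
    (1, [(1, 12)]),
    (3, [(64, 12), (192, 20), (32, 19), (3, 14)]),
    (3, [(64, 12), (32, 19), (3, 15), (192, 20)]),
    (3, [(64, 12), (192, 20), (32, 19), (3, 16)]),
    (3, [(64, 12), (32, 19), (192, 20), (3, 17)]),
    (3, [(64, 12), (32, 19), (192, 20), (3, 18)]),
    (3, [(64, 12), (32, 19), (3, 13), (192, 20)]),
    (1, [(6, 12), (12, 20), (1, 19)]),
    (1, [(1, 12), (1, 20)]),
    (953856, [(16823, 17), (10175, 14), (2566728, 25), (17552, 13), (51840, 26), (77112, 5)]),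
    (50544, [(349, 17), (2592, 21), (12960, 12), (355, 18), (349, 13), (84240, 25)]),
    (11781, [(691, 18), (10998, 22), (29, 13), (9504, 21), (50652, 12), (106290, 25)]),
    (1, [(1, 25)]),
    (20313, [(59, 18), (958, 17), (531, 25), (1116, 26), (60408, 12), (3132, 27)]),
    (1198591344, [(34316755, 18), (115551, 2), (953532756, 19), (9896852, 13), (329396112, 26),
      (140148, 0)]),
    (2199793514544, [(677711705923, 18), (78991443, 0), (10320485523120, 19), (87949387610, 13),
      (1542163016952, 28), (232967992536, 27)]),
    (6502660560, [(175579865, 13), (554402691, 5), (11811429720, 19), (1695394800, 28),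
      (215676, 0), (19031545, 14)])]

/-- Combinations expressing `-coneGensB i 0 • transvVec + coneGensB i` in `coneGensT`. -/
def addCert : Fin 29 → ℕ × List (ℕ × Fin 24) :=
  ![(163784, [(3237157, 19), (1503866, 11), (16837675, 12), (6856499, 18), (2814931, 4),
      (1397325, 22)]),
    (20473, [(5603, 19), (966, 11), (433, 12), (11421, 18), (5850, 4), (16683, 22)]),
    (1444397, [(980688, 8), (7988496, 18), (1257441, 4), (2208696, 12), (25367, 1), (1746413, 6)]),
    (121449, [(7346, 1), (331377, 6), (3748032, 12), (702192, 2), (18953, 4), (59472, 8)]),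
    (84995, [(140, 0), (51, 1), (42720, 18), (10680, 12), (28836, 7), (9790, 2)]),
    (89, [(89, 7), (1, 1), (1, 0)]),
    (81892, [(127715, 19), (23466, 11), (348005, 12), (82881, 18), (107647, 4), (303533, 22)]),
    (94784, [(23981, 4), (43602, 9), (1058242, 12), (13389, 7), (74906, 8), (70988, 18)]),
    (1198546, [(351769, 9), (441769, 8), (8882163, 12), (1953410, 18), (483951, 4), (1261565, 6)]),
    (81892, [(151219, 19), (16498, 11), (251969, 12), (134781, 18), (126487, 4), (396317, 22)]),
    (1789680, [(4516080, 2), (177600, 4), (4781, 0), (11592360, 12), (272891, 6), (154560, 8)]),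
    (163784, [(151647, 19), (37750, 11), (302441, 12), (345097, 18), (132349, 4), (190099, 22)]),
    (30580, [(275, 5), (3520, 9), (4240, 10), (1255, 3), (2379, 7), (154, 1)]),
    (14080, [(417339, 6), (5987080, 10), (215640, 4), (640640, 5), (187640, 11), (25509, 0)]),
    (73425, [(155687, 1), (2966370, 2), (1136352, 7), (38270, 4), (31655520, 10), (221280, 0)]),
    (8605959, [(23465505, 0), (494965344, 9), (106695170, 7), (47350594, 4), (89766504, 12),
      (3532333008, 10)]),
    (104484, [(15230304, 12), (638613, 1), (3871832, 3), (20357424, 10), (901045, 6),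
      (11997069, 5)]),
    (26121, [(499454, 3), (5418864, 10), (4316904, 12), (90459, 1), (1469482, 6), (4053462, 5)]),
    (5632, [(398043, 6), (2126344, 10), (125784, 4), (142208, 5), (177656, 11), (3333, 0)]),
    (293700, [(908245, 3), (6151680, 10), (1385463, 7), (704880, 2), (170643, 1), (21835, 0)]),
    (61160, [(19389, 7), (10720, 3), (14960, 9), (3080, 5), (1419, 1), (43040, 10)]),
    (9112, [(13975, 10), (30675, 6), (101726, 12), (14921, 5), (10597, 11), (69635, 14)]),
    (52350, [(7920, 10), (8400, 4), (344520, 12), (219960, 14), (1399, 0), (102919, 6)]),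
    (82147, [(1367021, 6), (178947, 4), (3356168, 12), (21088, 9), (781656, 14), (194288, 18)]),
    (35851, [(17605, 6), (7860, 4), (114016, 12), (1412, 18), (25516, 14), (20748, 19)]),
    (1139, [(10194, 12), (5681, 10), (5053, 6), (6020, 5), (307, 11), (4701, 14)]),
    (1490236, [(984698, 8), (29164927, 10), (1602987, 4), (5523433, 6), (489885, 12),
      (2588239, 11)]),
    (1671744, [(137571, 1), (149459856, 10), (119100480, 12), (112713543, 5), (54698515, 6),
      (1743800, 3)]),
    (563904, [(9299, 1), (22158864, 10), (857960, 4), (1242351, 5), (1775995, 6), (125800, 0)])]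

/-- Combinations expressing `-coneGensB i 0 • transvVec - coneGensB i` in `coneGensT`. -/
def subCert : Fin 29 → ℕ × List (ℕ × Fin 24) :=
  ![(1, [(1, 0), (30, 3), (30, 6), (120, 5), (180, 2)]),
    (3, [(1, 3), (2, 6), (6, 5), (3, 2)]),
    (1, [(1, 3), (6, 6), (12, 5)]),
    (1335, [(680, 0), (4895, 3), (56070, 2), (2670, 5), (4272, 7), (57, 1)]),
    (1, [(1, 6), (1, 5)]),
    (1, [(1, 6)]),
    (64080, [(3769, 0), (131720, 3), (34799, 6), (120, 1), (435210, 5), (734250, 2)]),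
    (12816, [(1981, 0), (12104, 6), (19580, 3), (48327, 5), (201, 1), (189570, 2)]),
    (6408, [(695, 0), (72, 1), (6319, 6), (28836, 5), (7654, 3), (64080, 2)]),
    (64080, [(3101, 0), (140620, 3), (92026, 6), (75, 1), (591405, 5), (686190, 2)]),
    (4272, [(405, 0), (3560, 3), (32218, 2), (1691, 5), (1068, 7), (49, 1)]),
    (21360, [(361, 0), (23140, 3), (41296, 6), (5, 1), (136615, 5), (91670, 2)]),
    (7480, [(33, 0), (573, 6), (110, 2), (1120, 11), (290, 4), (880, 8)]),
    (366179, [(1785641, 11), (13197357, 10), (149233370, 8), (9783220, 7), (3979696, 3),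
      (4850703, 12)]),
    (46725, [(262371, 0), (106265, 1), (1100841, 6), (695090, 4), (90780, 2), (15827760, 8)]),
    (46725, [(396264, 0), (81560, 1), (1403619, 6), (1271810, 4), (2686020, 2), (12367440, 8)]),
    (46725, [(416895, 0), (106997, 1), (10637280, 8), (719120, 4), (3983640, 2), (631722, 7)]),
    (46725, [(252190, 0), (105696, 1), (12367440, 8), (2969841, 7), (2686020, 2), (410290, 3)]),
    (46725, [(69535, 0), (81639, 1), (15827760, 8), (3272619, 7), (90780, 2), (987010, 3)]),
    (140800, [(74151, 0), (669561, 6), (2703360, 8), (445640, 4), (153560, 10), (337960, 11)]),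
    (37400, [(583, 0), (11313, 6), (1320, 2), (5520, 4), (25520, 8), (16160, 11)]),
    (97940, [(12232, 0), (62752, 8), (1468219, 2), (226033, 3), (611056, 16), (480883, 7)]),
    (618, [(25, 0), (2448, 16), (3570, 2), (892, 3), (1569, 5), (1599, 7)]),
    (618, [(31, 0), (5086, 3), (12708, 2), (15591, 5), (12528, 16), (6729, 7)]),
    (423, [(600, 16), (262, 3), (464, 2), (1105, 5), (264, 20), (355, 7)]),
    (73455, [(3967, 0), (599472, 8), (150838, 3), (680304, 2), (480393, 7), (70416, 16)]),
    (59808, [(8934, 0), (5641, 1), (961200, 8), (216181, 7), (157530, 2), (55536, 3)]),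
    (4485600, [(1499630, 0), (1839877, 1), (107566290, 2), (513344880, 8), (161032417, 7),
      (49548080, 3)]),
    (4485600, [(1562510, 0), (1068649, 1), (145269360, 8), (11415229, 7), (2346930, 2),
      (1658960, 3)])]

/-- `c = (d, l)` writes `d • p` as a combination of vectors `g i`, listed in `l` with natural number
coefficients. -/
def IsNonnegComb {m n : ℕ} (g : Fin m → Fin n → ℤ) (p : Fin n → ℤ)
    (c : ℕ × List (ℕ × Fin m)) : Prop :=
  0 < c.1 ∧ ∀ j, c.1 * p j = (c.2.map fun a => a.1 * g a.2 j).sum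

instance {m n : ℕ} (g : Fin m → Fin n → ℤ) (p : Fin n → ℤ) (c : ℕ × List (ℕ × Fin m)) :
    Decidable (IsNonnegComb g p c) :=
  inferInstanceAs (Decidable (_ ∧ _))

theorem flipCert_spec (i) : IsNonnegComb coneGensT (flipMatrix *ᵥ coneGensT i) (flipCert i) := by
  decide +kernel +revert

theorem negBCertT_spec (i) :
    IsNonnegComb coneGensB (negBMatrix *ᵥ coneGensT i) (negBCertT i) := by
  decide +kernel +revert

theorem negBCertB_spec (i) :
    IsNonnegComb coneGensB (negBMatrix *ᵥ coneGensB i) (negBCertB i) := by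
  decide +kernel +revert

theorem addCert_spec (i) :
    IsNonnegComb coneGensT (-coneGensB i 0 • transvVec + coneGensB i) (addCert i) := by
  decide +kernel +revert

theorem subCert_spec (i) :
    IsNonnegComb coneGensT (-coneGensB i 0 • transvVec - coneGensB i) (subCert i) := by
  decide +kernel +revert

theorem transvVec_isNonnegComb :
    IsNonnegComb coneGensT transvVec (89, [(1, 0), (1, 1)]) := by
  decide +kernel

theorem coneGensB_zero_neg (i) : coneGensB i 0 < 0 := by
  decide +kernel +revert

/-- The rational vector with the given integer coordinates. -/
def ratVec {n : ℕ} (v : Fin n → ℤ) : Fin n → ℚ := fun j => (v j : ℚ)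

theorem ratVec_mulVec {n : ℕ} (M : Matrix (Fin n) (Fin n) ℤ) (v : Fin n → ℤ) :
    ratVec (M *ᵥ v) = M.map (Int.castRingHom ℚ) *ᵥ ratVec v :=
  funext fun i => RingHom.map_mulVec (Int.castRingHom ℚ) M v i

/-- The rational cone spanned by finitely many integer vectors. -/
def ratCone {m n : ℕ} (g : Fin m → Fin n → ℤ) : PointedCone ℚ (Fin n → ℚ) :=
  PointedCone.hull ℚ (Set.range fun i => ratVec (g i))

theorem ratVec_mem_ratCone {m n : ℕ} (g : Fin m → Fin n → ℤ) (i : Fin m) :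
    ratVec (g i) ∈ ratCone g :=
  PointedCone.subset_hull ⟨i, rfl⟩

theorem IsNonnegComb.mem_ratCone {m n : ℕ} {g : Fin m → Fin n → ℤ} {p : Fin n → ℤ}
    {c : ℕ × List (ℕ × Fin m)} (h : IsNonnegComb g p c) : ratVec p ∈ ratCone g := by
  obtain ⟨hd, hp⟩ := h
  have hsum : (c.2.map fun a => (a.1 : ℚ) • ratVec (g a.2)).sum ∈ ratCone g := by
    refine list_sum_mem fun x hx => ?_
    obtain ⟨a, -, rfl⟩ := List.mem_map.mp hx
    exact (ratCone g).smul_mem (Nat.cast_nonneg _) (ratVec_mem_ratCone g _)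
  have hd' : (c.1 : ℚ) ≠ 0 := by exact_mod_cast hd.ne'
  have hc : ratVec p = (c.1 : ℚ)⁻¹ • (c.2.map fun a => (a.1 : ℚ) • ratVec (g a.2)).sum := by
    rw [eq_inv_smul_iff₀ hd']
    ext j
    have := congrArg (Int.cast : ℤ → ℚ) (hp j)
    push_cast at this
    simpa [ratVec, Pi.list_sum_apply, List.map_map, Function.comp_def] using this
  rw [hc]
  exact (ratCone g).smul_mem (inv_nonneg.mpr (Nat.cast_nonneg _)) hsum

theorem map_mem_of_mem_ratCone {m n : ℕ} {g : Fin m → Fin n → ℤ} {D : PointedCone ℚ (Fin n → ℚ)}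
    (L : (Fin n → ℚ) →ₗ[ℚ] (Fin n → ℚ)) (h : ∀ i, L (ratVec (g i)) ∈ D)
    {v : Fin n → ℚ} (hv : v ∈ ratCone g) : L v ∈ D := by
  have : ratCone g ≤ D.comap L := by
    refine Submodule.span_le.mpr ?_
    rintro _ ⟨i, rfl⟩
    exact h i
  exact this hv

theorem eq_zero_or_pos_of_mem_ratCone {m n : ℕ} {g : Fin m → Fin n → ℤ}
    (φ : (Fin n → ℚ) →ₗ[ℚ] ℚ) (h : ∀ i, 0 < φ (ratVec (g i)))
    {v : Fin n → ℚ} (hv : v ∈ ratCone g) : v = 0 ∨ 0 < φ v := by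
  induction hv using Submodule.span_induction with
  | mem x hx =>
    obtain ⟨i, rfl⟩ := hx
    exact .inr (h i)
  | zero => exact .inl rfl
  | add x y _ _ hx hy =>
    rcases hx with rfl | hx
    · simpa using hy
    · rcases hy with rfl | hy
      · exact .inr (by simpa using hx)
      · exact .inr (by simpa using add_pos hx hy)
  | smul a x _ hx =>
    rcases hx with rfl | hx
    · simp
    · rcases eq_or_ne a 0 with rfl | ha
      · simp
      · right
        change 0 < φ ((a : ℚ) • x)
        rw [map_smul, smul_eq_mul]
        exact mul_pos (by exact_mod_cast pos_iff_ne_zero.mpr ha) hx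

theorem companionMatrix_sub_one_pow_six_mulVec (v : Fin 6 → ℚ) :
    companionMatrix 6 ((X - 1) ^ 6 : ℚ[X]) *ᵥ v =
      ![-v 5, v 0 + 6 * v 5, v 1 - 15 * v 5, v 2 + 20 * v 5, v 3 - 15 * v 5, v 4 + 6 * v 5] := by
  have hp : ((X - 1) ^ 6 : ℚ[X]) = X ^ 6 + C (-6) * X ^ 5 + C 15 * X ^ 4 + C (-20) * X ^ 3 +
      C 15 * X ^ 2 + C (-6) * X + C 1 := by
    simp only [map_neg, map_one, map_ofNat]
    ring
  ext i
  fin_cases i <;>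
    simp [hp, companionMatrix, mulVec, dotProduct, Fin.sum_univ_six, coeff_X,
      coeff_X_pow, coeff_one] <;> ring

theorem companionMatrix_add_one_mulVec (v : Fin 6 → ℚ) :
    companionMatrix 6 ((X + 1) ^ 4 * (X ^ 2 + X + 1) : ℚ[X]) *ᵥ v =
      ![-v 5, v 0 - 5 * v 5, v 1 - 11 * v 5, v 2 - 14 * v 5, v 3 - 11 * v 5, v 4 - 5 * v 5] := by
  have hp : ((X + 1) ^ 4 * (X ^ 2 + X + 1) : ℚ[X]) = X ^ 6 + C 5 * X ^ 5 + C 11 * X ^ 4 +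
      C 14 * X ^ 3 + C 11 * X ^ 2 + C 5 * X + C 1 := by
    simp only [map_one, map_ofNat]
    ring
  ext i
  fin_cases i <;>
    simp [hp, companionMatrix, mulVec, dotProduct, Fin.sum_univ_six, coeff_X,
      coeff_X_pow, coeff_one] <;> ring

theorem negBMatrix_mulVec (v : Fin 6 → ℚ) :
    negBMatrix.map (Int.castRingHom ℚ) *ᵥ v =
      -(companionMatrix 6 ((X + 1) ^ 4 * (X ^ 2 + X + 1) : ℚ[X]) *ᵥ v) := by
  rw [companionMatrix_add_one_mulVec]
  ext i
  fin_cases i <;> simp [negBMatrix, mulVec, dotProduct, Fin.sum_univ_six] <;> ring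

theorem companionMatrix_mulVec_eq_transvection (v : Fin 6 → ℚ) :
    companionMatrix 6 ((X + 1) ^ 4 * (X ^ 2 + X + 1) : ℚ[X]) *ᵥ v =
      companionMatrix 6 ((X - 1) ^ 6 : ℚ[X]) *ᵥ v +
        (-(companionMatrix 6 ((X - 1) ^ 6 : ℚ[X]) *ᵥ v) 0) • ratVec transvVec := by
  rw [companionMatrix_add_one_mulVec, companionMatrix_sub_one_pow_six_mulVec]
  ext i
  fin_cases i <;> simp [transvVec, ratVec] <;> ring

/-- The hypergeometric group of case A2 is free of rank 2 on `T = B * A⁻¹` and `B`. -/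
theorem thm_A2 (A B : GL (Fin 6) ℚ)
    (hA : (A : Matrix (Fin 6) (Fin 6) ℚ) = companionMatrix 6 ((X - 1) ^ 6))
    (hB : (B : Matrix (Fin 6) (Fin 6) ℚ) = companionMatrix 6 ((X + 1) ^ 4 * (X ^ 2 + X + 1))) :
    Function.Injective (FreeGroup.lift ![B * A⁻¹, B] : FreeGroup (Fin 2) →* GL (Fin 6) ℚ) := by
  have smul_def : ∀ (g : GL (Fin 6) ℚ) (v : Fin 6 → ℚ),
      g • v = (g : Matrix (Fin 6) (Fin 6) ℚ) *ᵥ v := fun _ _ => rfl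
  let b : (Fin 6 → ℚ) →ₗ[ℚ] (Fin 6 → ℚ) := (negBMatrix.map (Int.castRingHom ℚ)).mulVecLin
  let e : (Fin 6 → ℚ) →ₗ[ℚ] (Fin 6 → ℚ) := (flipMatrix.map (Int.castRingHom ℚ)).mulVecLin
  let φ : (Fin 6 → ℚ) →ₗ[ℚ] ℚ := -LinearMap.proj 0
  have hφ : ∀ v, φ v = -v 0 := fun _ => rfl
  have hb : ∀ v, b (ratVec v) = ratVec (negBMatrix *ᵥ v) := fun v => (ratVec_mulVec _ v).symm
  have he : ∀ v, e (ratVec v) = ratVec (flipMatrix *ᵥ v) := fun v => (ratVec_mulVec _ v).symm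
  refine FreeGroup.lift_injective_of_cones (φ := φ) (u := ratVec transvVec) (b := b) (e := e)
    (C := ratCone coneGensT) (D := ratCone coneGensB) ?_ ?_ ?_ ?_ ?_ ?_ ?_ ?_ ?_ ?_ ?_ ?_ ?_ ?_ ?_
  · intro v
    obtain ⟨w, rfl⟩ := MulAction.surjective A v
    simp only [mul_smul, inv_smul_smul]
    rw [smul_def, smul_def, hA, hB, hφ]
    exact companionMatrix_mulVec_eq_transvection w
  · intro v
    rw [smul_def, hB]
    exact (neg_eq_iff_eq_neg.mpr (negBMatrix_mulVec v)).symm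
  · intro v
    have h : flipMatrix * flipMatrix = 1 := by decide +kernel
    simp only [e, mulVecLin_apply, mulVec_mulVec, ← Matrix.map_mul, h]
    simp
  · intro v
    have h : negBMatrix * (flipMatrix * (negBMatrix * flipMatrix)) = 1 := by decide +kernel
    simp only [b, e, mulVecLin_apply, mulVec_mulVec, ← Matrix.map_mul, h]
    simp
  · rw [he]
    exact congrArg ratVec (by decide +kernel)
  · intro v
    simp [hφ, e, flipMatrix, mulVec, dotProduct, Fin.sum_univ_six]
  · simp [hφ, ratVec, transvVec]
  · intro h
    simpa [ratVec, transvVec] using congrFun h 1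
  · exact transvVec_isNonnegComb.mem_ratCone
  · refine fun v => map_mem_of_mem_ratCone e fun i => ?_
    rw [he]
    exact (flipCert_spec i).mem_ratCone
  · refine fun v => map_mem_of_mem_ratCone b fun i => ?_
    rw [hb]
    exact (negBCertT_spec i).mem_ratCone
  · refine fun v => map_mem_of_mem_ratCone b fun i => ?_
    rw [hb]
    exact (negBCertB_spec i).mem_ratCone
  · intro v hv hv0
    refine (eq_zero_or_pos_of_mem_ratCone φ (fun i => ?_) hv).resolve_left hv0
    rw [hφ, neg_pos]
    exact Int.cast_lt_zero.mpr (coneGensB_zero_neg i)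
  · refine fun v => map_mem_of_mem_ratCone (φ.smulRight (ratVec transvVec) + LinearMap.id)
      fun i => ?_
    convert (addCert_spec i).mem_ratCone using 1
    ext j
    simp [hφ, ratVec]
  · refine fun v => map_mem_of_mem_ratCone (φ.smulRight (ratVec transvVec) - LinearMap.id)
      fun i => ?_
    convert (subCert_spec i).mem_ratCone using 1
    ext j
    simp [hφ, ratVec]
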